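/- For all q, r with 0 < r < q one has ∫_ℝ u_q(y) (u_r(0) − u_r(y)) dy = u_q(0)/(q − r) − r·u_r(0)/(q(q − r)). -/

import Mathlib

open MeasureTheory Set Filter Real

/-- The q-resolvent density `u_q(x) = (1/π) ∫_0^∞ cos(xλ)/(q + λ^α) dλ`. -/
noncomputable def resolventDensity (α q x : ℝ) : ℝ :=
  (1 / π) * ∫ l in Ioi (0 : ℝ), Real.cos (x * l) / (q + l ^ α)

open scoped FourierTransform

section Kernel

variable {α q : ℝ}

theorem integrableOn_one_div_add_rpow (hα : 1 < α) (hq : 0 < q) :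
    IntegrableOn (fun l : ℝ => 1 / (q + l ^ α)) (Ioi 0) := by
  have hmeas : Measurable fun l : ℝ => 1 / (q + l ^ α) := by fun_prop
  rw [← Ioc_union_Ioi_eq_Ioi zero_le_one]
  refine IntegrableOn.union ?_ ?_
  · refine Integrable.mono' (g := fun _ => 1 / q) (by simp)
      hmeas.aestronglyMeasurable ?_
    filter_upwards [ae_restrict_mem measurableSet_Ioc] with l hl
    have h := rpow_pos_of_pos hl.1 α
    rw [norm_of_nonneg (by positivity)]
    gcongr
    linarith
  · refine Integrable.mono' (integrableOn_Ioi_rpow_of_lt (neg_lt_neg hα) zero_lt_one)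
      hmeas.aestronglyMeasurable ?_
    filter_upwards [ae_restrict_mem measurableSet_Ioi] with l hl
    have hl0 : (0 : ℝ) < l := zero_lt_one.trans hl
    have h := rpow_pos_of_pos hl0 α
    rw [norm_of_nonneg (by positivity), rpow_neg hl0.le, ← one_div]
    gcongr
    linarith

theorem integrableOn_rpow_sub_two_div_sq (hα : 1 < α) (hq : 0 < q) :
    IntegrableOn (fun l : ℝ => l ^ (α - 2) / (q + l ^ α) ^ 2) (Ioi 0) := by
  have hmeas : Measurable fun l : ℝ => l ^ (α - 2) / (q + l ^ α) ^ 2 := by fun_prop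
  rw [← Ioc_union_Ioi_eq_Ioi zero_le_one]
  refine IntegrableOn.union ?_ ?_
  · have hint : IntegrableOn (fun l : ℝ => l ^ (α - 2) / q ^ 2) (Ioc 0 1) :=
      ((intervalIntegral.intervalIntegrable_rpow' (by linarith)).1).div_const _
    refine Integrable.mono' hint hmeas.aestronglyMeasurable ?_
    filter_upwards [ae_restrict_mem measurableSet_Ioc] with l hl
    have h := rpow_pos_of_pos hl.1 α
    have h2 := rpow_pos_of_pos hl.1 (α - 2)
    rw [norm_of_nonneg (by positivity)]
    gcongr
    linarith
  · have hint : IntegrableOn (fun l : ℝ => l ^ (-2 : ℝ) / q) (Ioi 1) :=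
      (integrableOn_Ioi_rpow_of_lt (by norm_num) zero_lt_one).div_const _
    refine Integrable.mono' hint hmeas.aestronglyMeasurable ?_
    filter_upwards [ae_restrict_mem measurableSet_Ioi] with l hl
    have hl0 : (0 : ℝ) < l := zero_lt_one.trans hl
    have h := rpow_pos_of_pos hl0 α
    have h2 := rpow_pos_of_pos hl0 (-2)
    rw [norm_of_nonneg (by positivity), sub_eq_add_neg, rpow_add hl0,
      div_le_div_iff₀ (by positivity) (by positivity)]
    have : l ^ α * q ≤ (q + l ^ α) ^ 2 := by nlinarith
    nlinarith

theorem hasDerivAt_one_div_add_rpow (hq : 0 < q) {l : ℝ} (hl : 0 < l) :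
    HasDerivAt (fun l : ℝ => 1 / (q + l ^ α)) (-(α * l ^ (α - 1) / (q + l ^ α) ^ 2)) l := by
  have h := rpow_pos_of_pos hl α
  have := (((hasDerivAt_rpow_const (p := α) (Or.inl hl.ne')).const_add q).fun_inv (by positivity))
  simpa only [one_div, neg_div] using this

theorem hasDerivAt_rpow_sub_one_div_sq (hq : 0 < q) {l : ℝ} (hl : 0 < l) :
    HasDerivAt (fun l : ℝ => l ^ (α - 1) / (q + l ^ α) ^ 2)
      ((α - 1 - 2 * α * (l ^ α / (q + l ^ α))) * (l ^ (α - 2) / (q + l ^ α) ^ 2)) l := by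
  have h := rpow_pos_of_pos hl α
  have h2 := (hasDerivAt_rpow_const (p := α - 1) (Or.inl hl.ne'))
  have h3 := (((hasDerivAt_rpow_const (p := α) (Or.inl hl.ne')).const_add q).fun_pow 2)
  refine (h2.fun_div h3 (by positivity)).congr_deriv ?_
  have e1 : l ^ (α - 1) = l ^ (α - 2) * l := by
    rw [← rpow_add_one hl.ne']; ring_nf
  have e2 : l ^ α = l ^ (α - 2) * l * l := by
    rw [← rpow_add_one hl.ne', ← rpow_add_one hl.ne']; ring_nf
  have e3 : α - 1 - 1 = α - 2 := by ring
  rw [e3, e1]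
  have hd : q + l ^ α ≠ 0 := by positivity
  field_simp
  rw [e2]
  ring

theorem tendsto_one_div_add_rpow_atTop (hα : 1 < α) :
    Tendsto (fun l : ℝ => 1 / (q + l ^ α)) atTop (nhds 0) :=
  (tendsto_atTop_add_const_left _ q (tendsto_rpow_atTop (by linarith))).const_div_atTop 1

theorem tendsto_rpow_sub_one_div_sq_atTop (hα : 1 < α) (hq : 0 < q) :
    Tendsto (fun l : ℝ => l ^ (α - 1) / (q + l ^ α) ^ 2) atTop (nhds 0) := by
  refine squeeze_zero' ?_ ?_ (tendsto_one_div_add_rpow_atTop (q := q) hα)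
  · filter_upwards [eventually_ge_atTop 0] with l hl
    positivity
  · filter_upwards [eventually_ge_atTop 1] with l hl
    have hl0 : (0 : ℝ) < l := zero_lt_one.trans_le hl
    have h := rpow_pos_of_pos hl0 α
    have h1 : l ^ (α - 1) ≤ l ^ α := rpow_le_rpow_of_exponent_le hl (by linarith)
    rw [div_le_div_iff₀ (by positivity) (by positivity)]
    nlinarith

theorem continuous_one_div_add_abs_rpow (hα : 1 < α) (hq : 0 < q) :
    Continuous fun l : ℝ => 1 / (q + |l| ^ α) := by
  refine continuous_const.div
    (continuous_const.add (continuous_abs.rpow_const fun _ => Or.inr (by linarith))) fun l => ?_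
  positivity

theorem tendsto_rpow_sub_one_div_sq_zero (hα : 1 < α) (hq : 0 < q) :
    Tendsto (fun l : ℝ => l ^ (α - 1) / (q + l ^ α) ^ 2) (nhdsWithin 0 (Ioi 0)) (nhds 0) := by
  have h1 : ContinuousAt (fun l : ℝ => l ^ (α - 1) / (q + l ^ α) ^ 2) 0 := by
    refine (continuousAt_rpow_const _ _ (Or.inr (by linarith))).div
      ((continuousAt_const.add (continuousAt_rpow_const _ _ (Or.inr (by linarith)))).pow 2) ?_
    rw [zero_rpow (by linarith)]
    positivity
  have h2 := h1.tendsto.mono_left (nhdsWithin_le_nhds (s := Ioi 0))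
  rwa [zero_rpow (by linarith), zero_div] at h2

theorem integrableOn_rpow_sub_one_div_sq (hα : 1 < α) (hq : 0 < q) :
    IntegrableOn (fun l : ℝ => l ^ (α - 1) / (q + l ^ α) ^ 2) (Ioi 0) := by
  have h := integrableOn_Ioi_deriv_of_nonpos (a := 0) (l := 0)
    (g := fun l : ℝ => 1 / (q + l ^ α)) (g' := fun l => -(α * l ^ (α - 1) / (q + l ^ α) ^ 2))
    ?_ (fun l hl => hasDerivAt_one_div_add_rpow hq hl) ?_ (tendsto_one_div_add_rpow_atTop hα)
  · refine (h.neg.div_const α).congr (ae_of_all _ fun l => ?_)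
    have : α ≠ 0 := by linarith
    simp only [Pi.neg_apply, neg_neg]
    field_simp
  · refine ((continuous_one_div_add_abs_rpow hα hq).continuousWithinAt (s := Ici 0)).congr ?_ ?_
    · intro y hy
      rw [abs_of_nonneg hy]
    · simp
  · intro l hl
    have hl' : (0 : ℝ) < l := hl
    have : 0 < α := by linarith
    have : 0 ≤ α * l ^ (α - 1) / (q + l ^ α) ^ 2 := by positivity
    linarith

theorem integrableOn_deriv_rpow_sub_one_div_sq (hα : 1 < α) (hq : 0 < q) :
    IntegrableOn (fun l : ℝ =>
      (α - 1 - 2 * α * (l ^ α / (q + l ^ α))) * (l ^ (α - 2) / (q + l ^ α) ^ 2)) (Ioi 0) := by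
  refine (integrableOn_rpow_sub_two_div_sq hα hq).bdd_mul (c := 3 * α)
    (Measurable.aestronglyMeasurable (by fun_prop)) ?_
  filter_upwards [ae_restrict_mem measurableSet_Ioi] with l hl
  have h := rpow_pos_of_pos hl α
  have h1 : l ^ α / (q + l ^ α) ≤ 1 := by
    rw [div_le_one (by positivity)]; linarith
  have h2 : 0 ≤ l ^ α / (q + l ^ α) := by positivity
  rw [norm_eq_abs, abs_le]
  constructor <;> nlinarith

end Kernel

section Decay

variable {α q : ℝ}

theorem tendsto_mul_div_zero_of_abs_le_one {F : Filter ℝ} {f s : ℝ → ℝ} (hf : Tendsto f F (nhds 0))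
    (hs : ∀ l, |s l| ≤ 1) (x : ℝ) : Tendsto (fun l => f l * (s l / x)) F (nhds 0) := by
  refine hf.zero_mul_isBoundedUnder_le ⟨1 / |x|, eventually_map.2 (Eventually.of_forall fun l => ?_)⟩
  simp only [Function.comp_apply, norm_eq_abs, abs_div]
  gcongr
  exact hs l

theorem integral_cos_mul_div_add_rpow (hα : 1 < α) (hq : 0 < q) {x : ℝ} (hx : x ≠ 0) :
    ∫ l in Ioi (0 : ℝ), Real.cos (x * l) / (q + l ^ α) =
      α / x ^ 2 * ∫ l in Ioi (0 : ℝ), Real.cos (x * l) *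
        ((α - 1 - 2 * α * (l ^ α / (q + l ^ α))) * (l ^ (α - 2) / (q + l ^ α) ^ 2)) := by
  have hsin (l : ℝ) : HasDerivAt (fun l => Real.sin (x * l) / x) (Real.cos (x * l)) l := by
    have := ((hasDerivAt_id l).const_mul x).sin.div_const x
    simpa [hx] using this
  have hcos (l : ℝ) : HasDerivAt (fun l => -Real.cos (x * l) / x) (Real.sin (x * l)) l := by
    have := (((hasDerivAt_id l).const_mul x).cos.neg).div_const x
    simpa [hx] using this
  have hg := integrableOn_rpow_sub_one_div_sq hα hq
  have hbound {s : ℝ → ℝ} (hs : ∀ l, |s l| ≤ 1) (l : ℝ) : ‖s l / x‖ ≤ 1 / |x| := by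
    rw [norm_eq_abs, abs_div]
    gcongr
    exact hs l
  have hneg (l : ℝ) : |-Real.cos (x * l)| ≤ 1 := by
    rw [abs_neg]
    exact abs_cos_le_one _
  have h1 := integral_Ioi_mul_deriv_eq_deriv_mul (a := 0) (a' := 0) (b' := 0)
    (fun l hl => hasDerivAt_one_div_add_rpow (α := α) hq hl) (fun l _ => hsin l)
    ((integrableOn_one_div_add_rpow hα hq).mul_bdd (c := 1)
      (Measurable.aestronglyMeasurable (by fun_prop)) (ae_of_all _ fun l => abs_cos_le_one _))
    (Integrable.mul_bdd (c := 1 / |x|)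
      ((hg.const_mul α).neg.congr (ae_of_all _ fun l => by simp only [Pi.neg_apply, mul_div_assoc]))
      (Measurable.aestronglyMeasurable (by fun_prop))
      (ae_of_all _ (hbound fun l => abs_sin_le_one _)))
    (by
      have hc : Continuous fun l : ℝ => 1 / (q + |l| ^ α) * (Real.sin (x * l) / x) :=
        (continuous_one_div_add_abs_rpow hα hq).mul (by fun_prop)
      have h := (hc.tendsto 0).mono_left (nhdsWithin_le_nhds (s := Ioi 0))
      simp only [mul_zero, Real.sin_zero, zero_div] at h
      refine h.congr' ?_
      filter_upwards [self_mem_nhdsWithin] with l hl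
      rw [abs_of_pos hl, Pi.mul_apply])
    (tendsto_mul_div_zero_of_abs_le_one (tendsto_one_div_add_rpow_atTop hα)
      (fun l => abs_sin_le_one _) x)
  have h2 := integral_Ioi_mul_deriv_eq_deriv_mul (a := 0) (a' := 0) (b' := 0)
    (fun l hl => hasDerivAt_rpow_sub_one_div_sq (α := α) hq hl) (fun l _ => hcos l)
    (hg.mul_bdd (c := 1)
      (Measurable.aestronglyMeasurable (by fun_prop)) (ae_of_all _ fun l => abs_sin_le_one _))
    ((integrableOn_deriv_rpow_sub_one_div_sq hα hq).mul_bdd (c := 1 / |x|)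
      (Measurable.aestronglyMeasurable (by fun_prop))
      (ae_of_all _ (hbound hneg)))
    (tendsto_mul_div_zero_of_abs_le_one (tendsto_rpow_sub_one_div_sq_zero hα hq) hneg x)
    (tendsto_mul_div_zero_of_abs_le_one (tendsto_rpow_sub_one_div_sq_atTop hα hq) hneg x)
  have e0 (l : ℝ) : Real.cos (x * l) / (q + l ^ α) = 1 / (q + l ^ α) * Real.cos (x * l) := by ring
  have e1 (l : ℝ) : -(α * l ^ (α - 1) / (q + l ^ α) ^ 2) * (Real.sin (x * l) / x) =
      -(α / x) * (l ^ (α - 1) / (q + l ^ α) ^ 2 * Real.sin (x * l)) := by ring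
  have e2 (l : ℝ) : (α - 1 - 2 * α * (l ^ α / (q + l ^ α))) * (l ^ (α - 2) / (q + l ^ α) ^ 2) *
      (-Real.cos (x * l) / x) = -(1 / x) * (Real.cos (x * l) *
        ((α - 1 - 2 * α * (l ^ α / (q + l ^ α))) * (l ^ (α - 2) / (q + l ^ α) ^ 2))) := by ring
  simp only [e1, integral_const_mul] at h1
  simp only [e2, integral_const_mul] at h2
  simp only [e0]
  rw [h1, h2]
  ring

theorem exists_sq_mul_abs_resolventDensity_le (hα : 1 < α) (hq : 0 < q) :
    ∃ C, ∀ x, x ^ 2 * |resolventDensity α q x| ≤ C := by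
  set w : ℝ → ℝ := fun l =>
    (α - 1 - 2 * α * (l ^ α / (q + l ^ α))) * (l ^ (α - 2) / (q + l ^ α) ^ 2) with hw
  have hint : IntegrableOn w (Ioi 0) := integrableOn_deriv_rpow_sub_one_div_sq hα hq
  have hα0 : 0 < α := by linarith
  refine ⟨1 / π * (α * ∫ l in Ioi (0 : ℝ), ‖w l‖), fun x => ?_⟩
  rcases eq_or_ne x 0 with rfl | hx
  · have : 0 ≤ ∫ l in Ioi (0 : ℝ), ‖w l‖ := integral_nonneg fun _ => norm_nonneg _
    have hp := pi_pos
    simp only [ne_eq, OfNat.ofNat_ne_zero, not_false_eq_true, zero_pow, zero_mul]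
    positivity
  · have hle : |∫ l in Ioi (0 : ℝ), Real.cos (x * l) * w l| ≤ ∫ l in Ioi (0 : ℝ), ‖w l‖ := by
      rw [← norm_eq_abs]
      refine norm_integral_le_of_norm_le hint.norm (ae_of_all _ fun l => ?_)
      rw [norm_mul]
      exact mul_le_of_le_one_left (norm_nonneg _) (abs_cos_le_one _)
    have hx2 : 0 < x ^ 2 := by positivity
    rw [resolventDensity, integral_cos_mul_div_add_rpow hα hq hx, abs_mul, abs_mul,
      abs_of_pos (show 0 < α / x ^ 2 by positivity), abs_of_pos (show 0 < 1 / π by positivity),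
      show ∀ A : ℝ, x ^ 2 * (1 / π * (α / x ^ 2 * A)) = 1 / π * (α * A) by
        intro A; field_simp]
    gcongr

end Decay

section Resolvent

variable {α q r : ℝ}

theorem integrable_one_div_add_abs_rpow (hα : 1 < α) (hq : 0 < q) :
    Integrable fun l : ℝ => 1 / (q + |l| ^ α) := by
  have hpos : IntegrableOn (fun l : ℝ => 1 / (q + |l| ^ α)) (Ioi 0) :=
    (integrableOn_one_div_add_rpow hα hq).congr_fun
      (fun l hl => by simp only [abs_of_pos (mem_Ioi.1 hl)]) measurableSet_Ioi
  have hneg : IntegrableOn (fun l : ℝ => 1 / (q + |l| ^ α)) (Iic 0) := by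
    have h := Iff.mpr integrableOn_Ici_iff_integrableOn_Ioi hpos
    rw [← neg_zero] at h
    simpa only [abs_neg] using h.comp_neg_Iic
  rw [← integrableOn_univ, ← Iic_union_Ioi (a := (0 : ℝ))]
  exact hneg.union hpos

theorem fourier_one_div_add_abs_rpow (hα : 1 < α) (hq : 0 < q) (x : ℝ) :
    𝓕 (fun l : ℝ => ((1 / (q + |l| ^ α) : ℝ) : ℂ)) x =
      ((2 * π * resolventDensity α q (2 * π * x) : ℝ) : ℂ) := by
  have hint := integrable_one_div_add_abs_rpow hα hq
  have hc : Integrable fun l : ℝ => Real.cos (2 * π * x * l) * (1 / (q + |l| ^ α)) :=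
    hint.bdd_mul (c := 1) (Measurable.aestronglyMeasurable (by fun_prop))
      (ae_of_all _ fun l => abs_cos_le_one _)
  have hs : Integrable fun l : ℝ => Real.sin (2 * π * x * l) * (1 / (q + |l| ^ α)) :=
    hint.bdd_mul (c := 1) (Measurable.aestronglyMeasurable (by fun_prop))
      (ae_of_all _ fun l => abs_sin_le_one _)
  have hs0 : ∫ l : ℝ, Real.sin (2 * π * x * l) * (1 / (q + |l| ^ α)) = 0 := by
    have h := integral_neg_eq_self
      (fun l : ℝ => Real.sin (2 * π * x * l) * (1 / (q + |l| ^ α))) volume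
    simp only [mul_neg, Real.sin_neg, abs_neg, neg_mul, integral_neg] at h
    linarith
  have hc0 : ∫ l : ℝ, Real.cos (2 * π * x * l) * (1 / (q + |l| ^ α)) =
      2 * π * resolventDensity α q (2 * π * x) := by
    have h := integral_comp_abs (f := fun l : ℝ => Real.cos (2 * π * x * l) * (1 / (q + l ^ α)))
    have habs (l : ℝ) : Real.cos (2 * π * x * |l|) = Real.cos (2 * π * x * l) := by
      rcases abs_choice l with h | h <;> simp [h]
    simp only [habs] at h
    rw [h, resolventDensity]
    simp only [mul_one_div]
    field_simp
  rw [fourier_real_eq_integral_exp_smul]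
  have hexp (l : ℝ) : Complex.exp (↑(-2 * π * l * x) * Complex.I) •
      ((1 / (q + |l| ^ α) : ℝ) : ℂ) =
      ((Real.cos (2 * π * x * l) * (1 / (q + |l| ^ α)) : ℝ) : ℂ) -
        ((Real.sin (2 * π * x * l) * (1 / (q + |l| ^ α)) : ℝ) : ℂ) * Complex.I := by
    rw [Complex.exp_mul_I, ← Complex.ofReal_cos, ← Complex.ofReal_sin, smul_eq_mul,
      show -2 * π * l * x = -(2 * π * x * l) by ring, Real.cos_neg, Real.sin_neg]
    push_cast
    ring
  simp only [hexp]
  rw [integral_sub hc.ofReal (hs.ofReal.mul_const _), integral_mul_const, integral_complex_ofReal,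
    integral_complex_ofReal, hs0, hc0]
  simp

theorem continuous_resolventDensity (hα : 1 < α) (hq : 0 < q) :
    Continuous (resolventDensity α q) := by
  refine continuous_const.mul (continuous_of_dominated (bound := fun l => 1 / (q + l ^ α)) ?_ ?_
    (integrableOn_one_div_add_rpow hα hq) ?_)
  · exact fun x => Measurable.aestronglyMeasurable (by fun_prop)
  · intro x
    filter_upwards [ae_restrict_mem measurableSet_Ioi] with l hl
    have h := rpow_pos_of_pos hl α
    have h0 : 0 < q + l ^ α := by positivity
    rw [norm_eq_abs, abs_div, abs_of_pos h0]
    gcongr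
    exact abs_cos_le_one _
  · exact ae_of_all _ fun l => by fun_prop

theorem abs_resolventDensity_le (hα : 1 < α) (hq : 0 < q) (x : ℝ) :
    |resolventDensity α q x| ≤ resolventDensity α q 0 := by
  rw [resolventDensity, resolventDensity, abs_mul, abs_of_pos (by positivity)]
  gcongr
  rw [← norm_eq_abs]
  refine norm_integral_le_of_norm_le (g := fun l => Real.cos (0 * l) / (q + l ^ α)) ?_ ?_
  · simp only [zero_mul, Real.cos_zero]
    exact integrableOn_one_div_add_rpow hα hq
  filter_upwards [ae_restrict_mem measurableSet_Ioi] with l hl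
  have h := rpow_pos_of_pos hl α
  have h0 : 0 < q + l ^ α := by positivity
  rw [norm_eq_abs, abs_div, abs_of_pos h0, zero_mul, Real.cos_zero]
  gcongr
  exact abs_cos_le_one _

theorem integrable_resolventDensity (hα : 1 < α) (hq : 0 < q) :
    Integrable (resolventDensity α q) := by
  obtain ⟨C, hC⟩ := exists_sq_mul_abs_resolventDensity_le hα hq
  refine (integrable_inv_one_add_sq.const_mul (resolventDensity α q 0 + C)).mono'
    (continuous_resolventDensity hα hq).aestronglyMeasurable (ae_of_all _ fun x => ?_)
  rw [norm_eq_abs, ← div_eq_mul_inv, le_div_iff₀ (by positivity)]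
  linarith [hC x, abs_resolventDensity_le hα hq x]

theorem integrable_fourier_one_div_add_abs_rpow (hα : 1 < α) (hq : 0 < q) :
    Integrable (𝓕 fun l : ℝ => ((1 / (q + |l| ^ α) : ℝ) : ℂ)) := by
  rw [funext (fourier_one_div_add_abs_rpow hα hq)]
  exact (((integrable_resolventDensity hα hq).comp_mul_left' two_pi_pos.ne').const_mul _).ofReal

theorem fourierInv_fourier_one_div_add_abs_rpow (hα : 1 < α) (hq : 0 < q) :
    𝓕⁻ (𝓕 fun l : ℝ => ((1 / (q + |l| ^ α) : ℝ) : ℂ)) =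
      fun l : ℝ => ((1 / (q + |l| ^ α) : ℝ) : ℂ) :=
  (Complex.continuous_ofReal.comp
    (continuous_one_div_add_abs_rpow hα hq)).fourierInv_fourier_eq
    (integrable_one_div_add_abs_rpow hα hq).ofReal
    (integrable_fourier_one_div_add_abs_rpow hα hq)

theorem integral_resolventDensity (hα : 1 < α) (hq : 0 < q) :
    ∫ y, resolventDensity α q y = 1 / q := by
  have h := congrFun (fourierInv_fourier_one_div_add_abs_rpow hα hq) 0
  rw [fourierInv_eq', funext (fourier_one_div_add_abs_rpow hα hq)] at h
  simp only [inner_zero_right, mul_zero, Complex.ofReal_zero, zero_mul, Complex.exp_zero, one_smul,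
    abs_zero, zero_rpow (show α ≠ 0 by linarith), add_zero] at h
  rw [integral_complex_ofReal, Complex.ofReal_inj, integral_const_mul,
    Measure.integral_comp_mul_left (resolventDensity α q), abs_of_pos (by positivity),
    smul_eq_mul, mul_inv_cancel_left₀ two_pi_pos.ne'] at h
  exact h

theorem integral_resolventDensity_mul (hα : 1 < α) (hq : 0 < q) (hr : 0 < r) :
    ∫ y, resolventDensity α q y * resolventDensity α r y =
      1 / π * ∫ l in Ioi (0 : ℝ), 1 / (q + l ^ α) * (1 / (r + l ^ α)) := by
  have h := VectorFourier.integral_fourierIntegral_smul_eq_flip (μ := volume) (ν := volume)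
    (L := innerₗ ℝ) continuous_fourierChar continuous_inner
    (f := fun l : ℝ => ((1 / (q + |l| ^ α) : ℝ) : ℂ))
    (integrable_one_div_add_abs_rpow hα hq).ofReal
    (integrable_fourier_one_div_add_abs_rpow hα hr)
  rw [flip_innerₗ] at h
  change ∫ ξ : ℝ, 𝓕 (fun l : ℝ => ((1 / (q + |l| ^ α) : ℝ) : ℂ)) ξ • _ =
    ∫ x : ℝ, _ • 𝓕 (𝓕 fun l : ℝ => ((1 / (r + |l| ^ α) : ℝ) : ℂ)) x at h
  have hinv (x : ℝ) : 𝓕 (𝓕 fun l : ℝ => ((1 / (r + |l| ^ α) : ℝ) : ℂ)) x =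
      ((1 / (r + |x| ^ α) : ℝ) : ℂ) := by
    have := congrFun (fourierInv_fourier_one_div_add_abs_rpow hα hr) (-x)
    rwa [fourierInv_eq_fourier_neg, neg_neg, abs_neg] at this
  simp only [hinv, fourier_one_div_add_abs_rpow hα hq, fourier_one_div_add_abs_rpow hα hr,
    smul_eq_mul, ← Complex.ofReal_mul] at h
  rw [integral_complex_ofReal, integral_complex_ofReal, Complex.ofReal_inj,
    Measure.integral_comp_mul_left (fun y => 2 * π * resolventDensity α q y *
      (2 * π * resolventDensity α r y)),
    integral_comp_abs (f := fun l : ℝ => 1 / (q + l ^ α) * (1 / (r + l ^ α))),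
    abs_of_pos (by positivity), smul_eq_mul] at h
  have h' (y : ℝ) : 2 * π * resolventDensity α q y * (2 * π * resolventDensity α r y) =
      (2 * π) ^ 2 * (resolventDensity α q y * resolventDensity α r y) := by ring
  simp only [h', integral_const_mul] at h
  field_simp at h ⊢
  linarith

theorem integral_resolventDensity_mul_of_ne (hα : 1 < α) (hq : 0 < q) (hr : 0 < r) (hqr : q ≠ r) :
    ∫ y, resolventDensity α q y * resolventDensity α r y =
      (resolventDensity α r 0 - resolventDensity α q 0) / (q - r) := by
  have hne : q - r ≠ 0 := sub_ne_zero.2 hqr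
  have h : ∫ l in Ioi (0 : ℝ), 1 / (q + l ^ α) * (1 / (r + l ^ α)) =
      ∫ l in Ioi (0 : ℝ), (1 / (r + l ^ α) - 1 / (q + l ^ α)) / (q - r) := by
    refine setIntegral_congr_fun measurableSet_Ioi fun l hl => ?_
    have h := rpow_pos_of_pos hl α
    have h1 : q + l ^ α ≠ 0 := by positivity
    have h2 : r + l ^ α ≠ 0 := by positivity
    field_simp
    ring
  rw [integral_resolventDensity_mul hα hq hr, h, integral_div,
    integral_sub (integrableOn_one_div_add_rpow hα hr) (integrableOn_one_div_add_rpow hα hq)]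
  simp only [resolventDensity, zero_mul, Real.cos_zero]
  ring

end Resolvent

/-- For `0 < r < q`,
`∫_ℝ u_q(y) (u_r(0) − u_r(y)) dy = u_q(0)/(q − r) − r u_r(0)/(q(q − r))`. -/
theorem resolvent_difference_integral (α : ℝ) (hα1 : 1 < α) (hα2 : α ≤ 2)
    (q r : ℝ) (hr : 0 < r) (hrq : r < q) :
    ∫ y : ℝ, resolventDensity α q y * (resolventDensity α r 0 - resolventDensity α r y)
      = resolventDensity α q 0 / (q - r)
        - r * resolventDensity α r 0 / (q * (q - r)) := by
  have hq : 0 < q := hr.trans hrq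
  have hint := integrable_resolventDensity hα1 hq
  have hmul : Integrable fun y => resolventDensity α q y * resolventDensity α r y :=
    hint.mul_bdd (c := resolventDensity α r 0)
      (continuous_resolventDensity hα1 hr).aestronglyMeasurable
      (ae_of_all _ (abs_resolventDensity_le hα1 hr))
  simp only [mul_sub]
  rw [integral_sub (hint.mul_const _) hmul, integral_mul_const, integral_resolventDensity hα1 hq,
    integral_resolventDensity_mul_of_ne hα1 hq hr hrq.ne']
  have hne : q - r ≠ 0 := sub_ne_zero.2 hrq.ne'
  field_simp
  ring
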